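/- Let Γ be a finite connected multigraph without self-loops with sink v* and reduced Laplacian L'. Then every entry of the real inverse matrix (L')^{-1} is non-negative; more precisely, the (i,j)-entry of (L')^{-1} equals |S₂(v_i, v_j)| / det(L'), where S₂(v_i, v_j) is the set of ordered spanning 2-forests (T₀, T₁) of Γ with v* ∈ T₀ and v_i, v_j ∈ T₁. -/

import Mathlib

open Matrix

noncomputable section

/-- A finite multigraph without self-loops: each edge `e` has a head and a tail. -/
structure Multigraph where
  V : Type
  E : Type
  fintypeV : Fintype V
  decEqV : DecidableEq V
  fintypeE : Fintype E
  decEqE : DecidableEq E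
  head : E → V
  tail : E → V
  loopless : ∀ e, head e ≠ tail e

namespace Multigraph

variable (G : Multigraph)

instance : Fintype G.V := G.fintypeV
instance : DecidableEq G.V := G.decEqV
instance : Fintype G.E := G.fintypeE
instance : DecidableEq G.E := G.decEqE

/-- `v` and `w` are joined by some edge belonging to `F`. -/
def edgeRel (F : Finset G.E) (v w : G.V) : Prop :=
  ∃ e ∈ F, (G.head e = v ∧ G.tail e = w) ∨ (G.head e = w ∧ G.tail e = v)

/-- Reachability using only edges in `F`. -/
def Reach (F : Finset G.E) : G.V → G.V → Prop :=
  Relation.EqvGen (G.edgeRel F)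

/-- The multigraph is connected. -/
def Connected : Prop := ∀ v w : G.V, G.Reach Finset.univ v w

/-- The number of edges joining `v` and `w`. -/
def edgeCount (v w : G.V) : ℕ :=
  Nat.card {e : G.E // (G.head e = v ∧ G.tail e = w) ∨ (G.head e = w ∧ G.tail e = v)}

/-- The degree of a vertex. -/
def degree (v : G.V) : ℕ :=
  Nat.card {e : G.E // G.head e = v ∨ G.tail e = v}

/-- The Laplacian matrix of the multigraph. -/
def laplacian : Matrix G.V G.V ℤ :=
  Matrix.of fun v w => if v = w then (G.degree v : ℤ) else -(G.edgeCount v w : ℤ)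

/-- The reduced Laplacian: delete the row and column of the sink `s`. -/
def reducedLaplacian (s : G.V) : Matrix {v : G.V // v ≠ s} {v : G.V // v ≠ s} ℤ :=
  Matrix.of fun v w => G.laplacian v.1 w.1

/-- A spanning tree, seen as a set of edges: it connects all vertices and has
`|V| - 1` edges. -/
def IsSpanningTree (T : Finset G.E) : Prop :=
  (∀ v w : G.V, G.Reach T v w) ∧ T.card + 1 = Fintype.card G.V

/-- The number of connected components of the spanning subgraph with edge set `F`. -/
def numComponents (F : Finset G.E) : ℕ :=
  Nat.card (Quotient (Relation.EqvGen.setoid (G.edgeRel F)))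

/-- `F` is the edge set of a spanning forest: the number of connected components of
`(V, F)` equals `|V| - |F|` (i.e. `F` is acyclic). -/
def IsForest (F : Finset G.E) : Prop :=
  G.numComponents F + F.card = Fintype.card G.V

end Multigraph

namespace Multigraph

open Classical in
/-- Signed incidence. -/
def inc (G : Multigraph) (e : G.E) (v : G.V) : ℤ :=
  (if G.head e = v then 1 else 0) - (if G.tail e = v then 1 else 0)

/-- Vertex `v` reaches the root set. -/
def Good (G : Multigraph) (S : Finset G.V) (F : Finset G.E) (v : G.V) : Prop :=
  ∃ r ∈ S, G.Reach F v r

/-- Rooted spanning forests. -/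
def Rooted (G : Multigraph) (S : Finset G.V) (F : Finset G.E) : Prop :=
  F.card + S.card = Fintype.card G.V ∧ ∀ v, G.Good S F v

variable {G : Multigraph}

theorem reach_const {α : Type*} {F : Finset G.E} (f : G.V → α)
    (hf : ∀ e ∈ F, f (G.head e) = f (G.tail e)) {v w : G.V} (h : G.Reach F v w) : f v = f w := by
  induction h with
  | rel x y h =>
    obtain ⟨e, he, ⟨rfl, rfl⟩ | ⟨rfl, rfl⟩⟩ := h
    · exact hf e he
    · exact (hf e he).symm
  | refl x => rfl
  | symm x y _ ih => exact ih.symm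
  | trans x y z _ _ h1 h2 => exact h1.trans h2

theorem Reach.rf {F : Finset G.E} (v : G.V) : G.Reach F v v := Relation.EqvGen.refl _

theorem Reach.sm {F : Finset G.E} {v w : G.V} (h : G.Reach F v w) : G.Reach F w v :=
  Relation.EqvGen.symm _ _ h

theorem Reach.tr {F : Finset G.E} {u v w : G.V} (h : G.Reach F u v) (h' : G.Reach F v w) :
    G.Reach F u w := Relation.EqvGen.trans _ _ _ h h'

theorem reach_edge {F : Finset G.E} {e : G.E} (he : e ∈ F) : G.Reach F (G.head e) (G.tail e) :=
  Relation.EqvGen.rel _ _ ⟨e, he, Or.inl ⟨rfl, rfl⟩⟩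

theorem Reach.mn {F F' : Finset G.E} (hF : F ⊆ F') {v w : G.V} (h : G.Reach F v w) :
    G.Reach F' v w :=
  Relation.EqvGen.mono (r := G.edgeRel F) (p := G.edgeRel F')
    (fun _ _ ⟨e, he, h⟩ => ⟨e, hF he, h⟩) _ _ h

theorem Reach.good {S : Finset G.V} {F : Finset G.E} {v w : G.V} (h : G.Reach F v w) :
    G.Good S F v ↔ G.Good S F w :=
  ⟨fun ⟨r, hr, h'⟩ => ⟨r, hr, h.sm.tr h'⟩, fun ⟨r, hr, h'⟩ => ⟨r, hr, h.tr h'⟩⟩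

theorem good_mem {S : Finset G.V} {F : Finset G.E} {v : G.V} (h : v ∈ S) : G.Good S F v :=
  ⟨v, h, Reach.rf v⟩

/-- Counting bound. -/
theorem card_le_of_good {S : Finset G.V} {F : Finset G.E} (h : ∀ v, G.Good S F v) :
    Fintype.card G.V ≤ F.card + S.card := by
  let φ : (G.V → ℚ) →ₗ[ℚ] ((F → ℚ) × (S → ℚ)) :=
    { toFun := fun f => (fun e => f (G.head e.1) - f (G.tail e.1), fun v => f v.1)
      map_add' := by
        intro f g
        ext x <;> simp; ring
      map_smul' := by
        intro c f
        ext x <;> simp; ring }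
  have hφ : Function.Injective φ := by
    rw [injective_iff_map_eq_zero]
    intro f hf
    have h1 : ∀ e ∈ F, f (G.head e) = f (G.tail e) := by
      intro e he
      have := congrFun (congrArg Prod.fst hf) ⟨e, he⟩
      simpa [φ, sub_eq_zero] using this
    have h2 : ∀ v ∈ S, f v = 0 := by
      intro v hv
      have := congrFun (congrArg Prod.snd hf) ⟨v, hv⟩
      simpa [φ] using this
    funext v
    obtain ⟨r, hr, hvr⟩ := h v
    rw [reach_const f h1 hvr, h2 r hr]; rfl
  have := LinearMap.finrank_le_finrank_of_injective hφ
  simpa using this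

theorem Rooted.sep {S : Finset G.V} {j : G.V} (hj : j ∉ S) {F : Finset G.E}
    (h : G.Rooted (insert j S) F) : ¬ G.Good S F j := by
  intro hg
  have : ∀ v, G.Good S F v := by
    intro v
    obtain ⟨r, hr, hvr⟩ := h.2 v
    rcases Finset.mem_insert.1 hr with rfl | hr
    · exact hvr.good.2 hg
    · exact ⟨r, hr, hvr⟩
  have h1 := card_le_of_good this
  have h2 := h.1
  rw [Finset.card_insert_of_notMem hj] at h2
  omega

/-- Removing an edge from a rooted forest: exactly one endpoint becomes bad. -/
theorem Rooted.erase_ends {S : Finset G.V} {F : Finset G.E} (h : G.Rooted S F) {e : G.E}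
    (he : e ∈ F) :
    ¬ (G.Good S (F.erase e) (G.head e) ↔ G.Good S (F.erase e) (G.tail e)) := by
  intro hi
  have hall : ∀ v, G.Good S (F.erase e) v := by
    intro v
    obtain ⟨r, hr, hvr⟩ := h.2 v
    have := reach_const (fun v => G.Good S (F.erase e) v) (F := F) (by
      intro e' he'
      by_cases hee : e' = e
      · subst hee; exact propext hi
      · exact propext (reach_edge (Finset.mem_erase.2 ⟨hee, he'⟩)).good) hvr
    exact this.mpr (good_mem hr)
  have h1 := card_le_of_good hall
  have h2 := h.1
  have h3 := Finset.card_erase_add_one he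
  omega

theorem Rooted.bad_reach {S : Finset G.V} {F : Finset G.E} (h : G.Rooted S F) {e : G.E}
    (he : e ∈ F) {v w : G.V} (hv : ¬ G.Good S (F.erase e) v) (hw : ¬ G.Good S (F.erase e) w) :
    G.Reach (F.erase e) v w := by
  have key : ∀ b, (G.Good S (F.erase e) (G.head e) ∨ G.Reach (F.erase e) (G.head e) b) →
      (G.Good S (F.erase e) (G.tail e) ∨ G.Reach (F.erase e) (G.tail e) b) →
      ∀ v, ¬ G.Good S (F.erase e) v → G.Reach (F.erase e) v b := by
    intro b h1 h2 v hv
    obtain ⟨r, hr, hvr⟩ := h.2 v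
    have := reach_const (fun v => G.Good S (F.erase e) v ∨ G.Reach (F.erase e) v b) (F := F) (by
      intro e' he'
      by_cases hee : e' = e
      · subst hee; simp only [h1, h2]
      · have hr := reach_edge (Finset.mem_erase.2 ⟨hee, he'⟩)
        refine propext (or_congr hr.good ⟨fun h => hr.sm.tr h, fun h => hr.tr h⟩)) hvr
    exact (this.mpr (Or.inl (good_mem hr))).resolve_left hv
  have hne := h.erase_ends he
  by_cases hh : G.Good S (F.erase e) (G.head e)
  · have := key (G.tail e) (Or.inl hh) (Or.inr (Reach.rf _))
    exact (this v hv).tr (this w hw).sm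
  · have ht : G.Good S (F.erase e) (G.tail e) := by tauto
    have := key (G.head e) (Or.inr (Reach.rf _)) (Or.inl ht)
    exact (this v hv).tr (this w hw).sm

theorem Rooted.erase {S : Finset G.V} {F : Finset G.E} (h : G.Rooted S F) {e : G.E}
    (he : e ∈ F) {j : G.V} (hj : ¬ G.Good S (F.erase e) j) :
    G.Rooted (insert j S) (F.erase e) := by
  have hjS : j ∉ S := fun h => hj (good_mem h)
  refine ⟨?_, ?_⟩
  · rw [Finset.card_insert_of_notMem hjS, ← h.1, ← Finset.card_erase_add_one he]; ring
  · intro v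
    by_cases hv : G.Good S (F.erase e) v
    · obtain ⟨r, hr, h⟩ := hv
      exact ⟨r, Finset.mem_insert_of_mem hr, h⟩
    · exact ⟨j, Finset.mem_insert_self _ _, h.bad_reach he hv hj⟩

theorem Rooted.insert_edge {S : Finset G.V} {F : Finset G.E} {j : G.V} (hj : j ∉ S)
    (h : G.Rooted (insert j S) F) {e : G.E}
    (he : ¬ (G.Reach F (G.head e) j ↔ G.Reach F (G.tail e) j)) :
    e ∉ F ∧ G.Rooted S (insert e F) := by
  have heF : e ∉ F := fun hm => he
    ⟨fun h => (reach_edge hm).sm.tr h, fun h => (reach_edge hm).tr h⟩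
  refine ⟨heF, ?_, ?_⟩
  · rw [Finset.card_insert_of_notMem heF, ← h.1, Finset.card_insert_of_notMem hj]; ring
  · have hsub : F ⊆ insert e F := Finset.subset_insert _ _
    have hedge : G.Reach (insert e F) (G.head e) (G.tail e) :=
      reach_edge (Finset.mem_insert_self _ _)
    have hgood : ∀ v, ¬ G.Reach F v j → G.Good S (insert e F) v := by
      intro v hv
      obtain ⟨r, hr, hvr⟩ := h.2 v
      rcases Finset.mem_insert.1 hr with rfl | hr
      · exact absurd hvr hv
      · exact ⟨r, hr, hvr.mn hsub⟩
    have hgj : G.Good S (insert e F) j := by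
      by_cases hh : G.Reach F (G.head e) j
      · have ht : ¬ G.Reach F (G.tail e) j := by tauto
        exact ((hh.mn hsub).sm.tr hedge).good.2 (hgood _ ht)
      · have ht : G.Reach F (G.tail e) j := by tauto
        exact ((ht.mn hsub).sm.tr hedge.sm).good.2 (hgood _ hh)
    intro v
    by_cases hv : G.Reach F v j
    · exact (hv.mn hsub).good.2 hgj
    · exact hgood v hv

open Classical in
/-- indicator of bad vertices -/
def bad (S : Finset G.V) (F : Finset G.E) (v : G.V) : ℤ := if G.Good S F v then 0 else 1

open Classical in
theorem sum_inc (e : G.E) (f : G.V → ℤ) :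
    ∑ v, G.inc e v * f v = f (G.head e) - f (G.tail e) := by
  simp [inc, sub_mul, Finset.sum_sub_distrib]

open Classical in
theorem laplacian_eq (v w : G.V) : G.laplacian v w = ∑ e, G.inc e v * G.inc e w := by
  unfold laplacian
  simp only [Matrix.of_apply]
  split_ifs with h
  · subst h
    rw [degree, Nat.card_eq_fintype_card, Fintype.card_subtype, Finset.card_filter]
    push_cast
    refine Finset.sum_congr rfl fun e _ => ?_
    have := G.loopless e
    unfold inc
    split_ifs <;> simp_all
  · rw [edgeCount, Nat.card_eq_fintype_card, Fintype.card_subtype, Finset.card_filter]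
    push_cast
    rw [← Finset.sum_neg_distrib]
    refine Finset.sum_congr rfl fun e _ => ?_
    have := G.loopless e
    unfold inc
    split_ifs <;> simp_all

/-- Per-forest flow identity. -/
theorem Rooted.flow {S : Finset G.V} {F : Finset G.E} (h : G.Rooted S F) {i j : G.V}
    (hi : i ∉ S) (hj : j ∉ S) :
    ∑ e ∈ F, G.inc e i * (bad S (F.erase e) j *
      (bad S (F.erase e) (G.head e) - bad S (F.erase e) (G.tail e))) = if i = j then 1 else 0 := by
  classical
  let ε : G.E → ℤ := fun e => bad S (F.erase e) (G.head e) - bad S (F.erase e) (G.tail e)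
  let B : Matrix F {v : G.V // v ∉ S} ℤ := fun e v => ε e.1 * G.inc e.1 v.1
  let X : Matrix {v : G.V // v ∉ S} F ℤ := fun v e => bad S (F.erase e.1) v.1
  have hBX : B * X = 1 := by
    ext e e'
    rw [Matrix.mul_apply]
    have h1 : ∑ v : {v : G.V // v ∉ S}, B e v * X v e' =
        ε e.1 * ∑ v, G.inc e.1 v * bad S (F.erase e'.1) v := by
      rw [Finset.mul_sum, ← Finset.sum_filter_add_sum_filter_not Finset.univ (fun v => v ∉ S)]
      rw [Finset.sum_eq_zero (s := Finset.univ.filter (fun v => ¬ v ∉ S)), add_zero]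
      · rw [← Finset.sum_subtype_eq_sum_filter]
        simp only [Finset.subtype_univ]
        refine Finset.sum_congr rfl fun v _ => ?_
        simp only [X, B]; ring
      · intro v hv
        have hv' : v ∈ S := by simpa using hv
        simp [bad, good_mem hv']
    rw [h1, sum_inc, Matrix.one_apply]
    split_ifs with hee
    · subst hee
      have := h.erase_ends e.2
      simp only [ε, bad]
      split_ifs <;> simp_all
    · have hr : G.Reach (F.erase e'.1) (G.head e.1) (G.tail e.1) :=
        reach_edge (Finset.mem_erase.2 ⟨fun h => hee (Subtype.ext h), e.2⟩)
      have : bad S (F.erase e'.1) (G.head e.1) = bad S (F.erase e'.1) (G.tail e.1) := by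
        simp only [bad, hr.good (S := S)]
      rw [this]; ring
  have hcard : Fintype.card F = Fintype.card {v : G.V // v ∉ S} := by
    have := h.1
    rw [Fintype.card_subtype_compl, Fintype.card_coe, Fintype.card_coe]
    omega
  have hXB : X * B = 1 := (Matrix.mul_eq_one_comm_of_equiv (Fintype.equivOfCardEq hcard)).1 hBX
  have := congrFun (congrFun hXB ⟨j, hj⟩) ⟨i, hi⟩
  rw [Matrix.mul_apply, Matrix.one_apply] at this
  rw [← Finset.sum_coe_sort]
  convert this using 1
  · refine Finset.sum_congr rfl fun e _ => ?_
    simp only [X, B, ε]; ring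
  · simp [eq_comm]

open Classical in
/-- number of rooted forests in which `j` is connected to `k` -/
def cnt (S : Finset G.V) (j k : G.V) : ℤ :=
  ∑ F : Finset G.E, if G.Rooted (insert j S) F ∧ G.Reach F k j then 1 else 0

open Classical in
def cnt0 (S : Finset G.V) : ℤ := ∑ F : Finset G.E, if G.Rooted S F then 1 else 0

open Classical in
def reachInd (F : Finset G.E) (j k : G.V) : ℤ := if G.Reach F k j then 1 else 0

open Classical in
theorem exchange (S : Finset G.V) {j : G.V} (hj : j ∉ S) (e : G.E) :
    ∑ F : Finset G.E with G.Rooted (insert j S) F,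
      (reachInd F j (G.head e) - reachInd F j (G.tail e)) =
    ∑ F : Finset G.E with G.Rooted S F, if e ∈ F then bad S (F.erase e) j *
      (bad S (F.erase e) (G.head e) - bad S (F.erase e) (G.tail e)) else 0 := by
  have hne : ∀ F : Finset G.E, reachInd F j (G.head e) - reachInd F j (G.tail e) ≠ 0 →
      ¬ (G.Reach F (G.head e) j ↔ G.Reach F (G.tail e) j) := by
    intro F h hi
    simp [reachInd, hi] at h
  have hbad : ∀ F, G.Rooted S F → e ∈ F → ¬ G.Good S (F.erase e) j → ∀ v,
      bad S (F.erase e) v = reachInd (F.erase e) j v := by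
    intro F hF he hb v
    have : G.Good S (F.erase e) v ↔ ¬ G.Reach (F.erase e) v j :=
      ⟨fun h h' => hb (h'.good.1 h), fun h => by
        by_contra h'
        exact h (hF.bad_reach he h' hb)⟩
    simp only [bad, reachInd, this]
    split_ifs <;> rfl
  refine Finset.sum_bij_ne_zero (fun F _ _ => insert e F) ?_ ?_ ?_ ?_
  · intro F hF h0
    simp only [Finset.mem_filter, Finset.mem_univ, true_and] at hF ⊢
    exact (hF.insert_edge hj (hne F h0)).2
  · intro F hF h0 F' hF' h0' heq
    simp only [Finset.mem_filter, Finset.mem_univ, true_and] at hF hF'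
    have h1 := (hF.insert_edge hj (hne F h0)).1
    have h2 := (hF'.insert_edge hj (hne F' h0')).1
    rw [← Finset.erase_insert h1, heq, Finset.erase_insert h2]
  · intro F hF h0
    simp only [Finset.mem_filter, Finset.mem_univ, true_and] at hF
    have he : e ∈ F := by by_contra h; simp [h] at h0
    have hb : ¬ G.Good S (F.erase e) j := by
      intro h; simp [bad, h] at h0
    refine ⟨F.erase e, ?_, ?_, Finset.insert_erase he⟩
    · simpa using hF.erase he hb
    · simp only [he, if_true] at h0
      rw [← hbad F hF he hb, ← hbad F hF he hb]
      exact right_ne_zero_of_mul h0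
  · intro F hF h0
    simp only [Finset.mem_filter, Finset.mem_univ, true_and] at hF
    have h1 := hF.insert_edge hj (hne F h0)
    have hb : ¬ G.Good S ((insert e F).erase e) j := by
      rw [Finset.erase_insert h1.1]; exact hF.sep hj
    have h2 := hbad _ h1.2 (Finset.mem_insert_self _ _) hb
    simp only [Finset.mem_insert_self, if_true, h2]
    rw [Finset.erase_insert h1.1]
    simp [reachInd, Reach.rf]

theorem lap_cnt (S : Finset G.V) {i j : G.V} (hi : i ∉ S) (hj : j ∉ S) :
    ∑ k, G.laplacian i k * cnt S j k = if i = j then cnt0 S else 0 := by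
  classical
  have h1 : ∀ k, cnt S j k = ∑ F : Finset G.E with G.Rooted (insert j S) F, reachInd F j k := by
    intro k
    rw [cnt, Finset.sum_filter]
    refine Finset.sum_congr rfl fun F _ => ?_
    simp only [reachInd]
    split_ifs <;> simp_all
  calc ∑ k, G.laplacian i k * cnt S j k
      = ∑ e, G.inc e i * ∑ k, G.inc e k * cnt S j k := by
        simp only [laplacian_eq, Finset.sum_mul, Finset.mul_sum]
        rw [Finset.sum_comm]
        simp only [mul_assoc]
    _ = ∑ e, G.inc e i * ∑ F : Finset G.E with G.Rooted (insert j S) F,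
      (reachInd F j (G.head e) - reachInd F j (G.tail e)) := by
        simp only [sum_inc, h1, Finset.sum_sub_distrib]
    _ = ∑ F : Finset G.E with G.Rooted S F, ∑ e ∈ F, G.inc e i * (bad S (F.erase e) j *
      (bad S (F.erase e) (G.head e) - bad S (F.erase e) (G.tail e))) := by
        simp only [exchange S hj, Finset.mul_sum]
        rw [Finset.sum_comm]
        refine Finset.sum_congr rfl fun F _ => ?_
        simp [mul_ite, Finset.sum_ite_mem]
    _ = ∑ F : Finset G.E with G.Rooted S F, if i = j then 1 else 0 := by
        refine Finset.sum_congr rfl fun F hF => ?_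
        simp only [Finset.mem_filter, Finset.mem_univ, true_and] at hF
        exact hF.flow hi hj
    _ = _ := by
        split_ifs <;> simp [cnt0]

theorem cnt_root (S : Finset G.V) {j k : G.V} (hj : j ∉ S) (hk : k ∈ S) : cnt S j k = 0 := by
  classical
  refine Finset.sum_eq_zero fun F _ => if_neg ?_
  rintro ⟨h, h'⟩
  exact h.sep hj ⟨k, hk, h'.sm⟩

theorem cnt_self (S : Finset G.V) (j : G.V) : cnt S j j = cnt0 (insert j S) := by
  classical
  refine Finset.sum_congr rfl fun F _ => ?_
  have h : G.Reach F j j := Reach.rf j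
  simp only [h, and_true]

open Classical in
/-- Laplacian with rows in `S` replaced by identity rows -/
def redM (G : Multigraph) (S : Finset G.V) : Matrix G.V G.V ℤ :=
  Matrix.of fun v w => if v ∈ S then (if v = w then 1 else 0) else G.laplacian v w

theorem redM_cnt (S : Finset G.V) {j : G.V} (hj : j ∉ S) :
    G.redM S *ᵥ (cnt S j) = Pi.single j (cnt0 S) := by
  classical
  funext i
  by_cases hi : i ∈ S
  · have : i ≠ j := fun h => hj (h ▸ hi)
    simp [Matrix.mulVec, dotProduct, redM, hi, this, cnt_root S hj hi]
  · have := lap_cnt S hi hj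
    simp only [Matrix.mulVec, dotProduct, redM, hi, Matrix.of_apply, if_false, this,
      Pi.single_apply]

theorem det_insert (S : Finset G.V) {j : G.V} (hj : j ∉ S) :
    (G.redM S).det * cnt0 (insert j S) = cnt0 S * (G.redM (insert j S)).det := by
  classical
  have h := congrArg (fun x => (G.redM S).adjugate *ᵥ x) (redM_cnt S hj)
  simp only [Matrix.mulVec_mulVec, Matrix.adjugate_mul] at h
  have h' := congrFun h j
  rw [Matrix.smul_mulVec, Matrix.one_mulVec] at h'
  simp only [Pi.smul_apply, smul_eq_mul, cnt_self, Matrix.mulVec_single] at h'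
  rw [h']
  have : (G.redM S).updateRow j (Pi.single j 1) = G.redM (insert j S) := by
    ext v w
    by_cases hv : v = j
    · subst hv; simp [redM, Pi.single_apply, eq_comm]
    · simp [redM, hv, Matrix.updateRow_apply]
  simp [Matrix.adjugate_apply, this, mul_comm]

theorem exists_rooted (hG : G.Connected) {S : Finset G.V} (hS : S.Nonempty) {j : G.V} (hj : j ∉ S)
    {F : Finset G.E} (hF : G.Rooted (insert j S) F) : ∃ F', G.Rooted S F' := by
  by_contra hno
  push Not at hno
  have : ∀ e, (G.Reach F (G.head e) j ↔ G.Reach F (G.tail e) j) := by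
    intro e
    by_contra he
    exact hno _ (hF.insert_edge hj he).2
  obtain ⟨r, hr⟩ := hS
  have h := reach_const (fun v => G.Reach F v j) (fun e _ => propext (this e)) (hG j r)
  exact hF.sep hj ⟨r, hr, (h.mp (Reach.rf j)).sm⟩

theorem cnt0_pos {S : Finset G.V} {F : Finset G.E} (h : G.Rooted S F) : 0 < cnt0 S := by
  classical
  refine Finset.sum_pos' (fun F _ => by split_ifs <;> simp) ⟨F, Finset.mem_univ _, by simp [h]⟩

theorem det_redM (hG : G.Connected) (n : ℕ) : ∀ S : Finset G.V, S.Nonempty → Sᶜ.card = n →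
    (G.redM S).det = cnt0 S ∧ ∃ F, G.Rooted S F := by
  classical
  induction n with
  | zero =>
    intro S _ h
    have : S = Finset.univ := by simpa using h
    subst this
    have hr : ∀ F : Finset G.E, G.Rooted Finset.univ F ↔ F = ∅ := by
      intro F
      constructor
      · intro h; simpa using h.1
      · rintro rfl
        exact ⟨by simp, fun v => good_mem (Finset.mem_univ v)⟩
    refine ⟨?_, ∅, (hr _).2 rfl⟩
    have : G.redM Finset.univ = 1 := by
      ext v w; simp [redM, Matrix.one_apply]
    simp [this, cnt0, hr]
  | succ n ih =>
    intro S hS h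
    have : Sᶜ.Nonempty := by rw [← Finset.card_pos]; omega
    obtain ⟨j, hj⟩ := this
    rw [Finset.mem_compl] at hj
    obtain ⟨h1, F, hF⟩ := ih (insert j S) (Finset.insert_nonempty _ _) (by
      rw [Finset.card_compl] at h ⊢
      rw [Finset.card_insert_of_notMem hj]; omega)
    refine ⟨?_, exists_rooted hG hS hj hF⟩
    have h2 := det_insert S hj
    rw [h1] at h2
    exact mul_right_cancel₀ (cnt0_pos hF).ne' h2

theorem det_reduced (s : G.V) : (G.reducedLaplacian s).det = (G.redM {s}).det := by
  classical
  rw [Matrix.twoBlockTriangular_det (G.redM {s}) (fun v => v ≠ s)]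
  · have h1 : (Matrix.toSquareBlockProp (G.redM {s}) (fun v => ¬ v ≠ s)) = 1 := by
      ext ⟨v, hv⟩ ⟨w, hw⟩
      rw [not_not] at hv hw
      subst hv hw
      simp [Matrix.toSquareBlockProp, redM]
    rw [h1, Matrix.det_one, mul_one]
    congr 1
    ext ⟨v, hv⟩ ⟨w, hw⟩
    simp [Matrix.toSquareBlockProp, redM, reducedLaplacian, hv]
  · intro v hv w hw
    rw [not_not] at hv
    subst hv
    simp [redM, Ne.symm hw]

theorem rooted_iff (s i j : G.V) (hj : j ≠ s) (F : Finset G.E) :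
    (G.Rooted (insert j {s}) F ∧ G.Reach F i j) ↔
    (G.IsForest F ∧ G.numComponents F = 2 ∧ ¬ G.Reach F s i ∧ G.Reach F i j) := by
  classical
  have hj' : j ∉ ({s} : Finset G.V) := by simpa using hj
  have hc : (insert j ({s} : Finset G.V)).card = 2 := by
    rw [Finset.card_insert_of_notMem hj']; simp
  have hq : ∀ v w : G.V, (Quotient.mk (Relation.EqvGen.setoid (G.edgeRel F)) v = Quotient.mk _ w)
      ↔ G.Reach F v w := fun v w => Quotient.eq
  constructor
  · rintro ⟨h, hij⟩
    have hsep := h.sep hj'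
    have hsj : ¬ G.Reach F s j := fun h => hsep ⟨s, by simp, h.sm⟩
    have h2 : G.numComponents F = 2 := by
      rw [numComponents, Nat.card_eq_two_iff]
      refine ⟨Quotient.mk _ s, Quotient.mk _ j, fun h => hsj ((hq _ _).1 h), ?_⟩
      rw [Set.eq_univ_iff_forall]
      intro x
      induction x using Quotient.inductionOn with
      | h v =>
        obtain ⟨r, hr, hv⟩ := h.2 v
        simp only [Finset.mem_insert, Finset.mem_singleton] at hr
        rcases hr with rfl | rfl
        · right; exact (hq _ _).2 hv
        · left; exact (hq _ _).2 hv
    refine ⟨?_, h2, fun h => hsj (h.tr hij), hij⟩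
    have := h.1
    unfold IsForest
    omega
  · rintro ⟨hf, h2, hsi, hij⟩
    refine ⟨⟨?_, ?_⟩, hij⟩
    · unfold IsForest at hf
      omega
    · intro v
      have hsj : ¬ G.Reach F s j := fun h => hsi (h.tr hij.sm)
      rw [numComponents, Nat.card_eq_two_iff' (Quotient.mk _ s)] at h2
      obtain ⟨y, hy, hu⟩ := h2
      by_cases hv : G.Reach F v s
      · exact ⟨s, by simp, hv⟩
      · refine ⟨j, by simp, (hq _ _).1 ?_⟩
        rw [hu (Quotient.mk _ v) (fun h => hv ((hq _ _).1 h)),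
          hu (Quotient.mk _ j) (fun h => hsj ((hq _ _).1 h).sm)]

theorem card_eq_cnt (s i j : G.V) (hj : j ≠ s) :
    (Nat.card {F : Finset G.E // G.IsForest F ∧ G.numComponents F = 2 ∧
          ¬ G.Reach F s i ∧ G.Reach F i j} : ℤ) = cnt {s} j i := by
  classical
  simp only [← rooted_iff s i j hj, cnt]
  rw [Nat.card_eq_fintype_card, Fintype.card_subtype, Finset.card_filter]
  push_cast
  rfl

end Multigraph

/-- The `(i,j)`-entry of the inverse of the (real) reduced Laplacian equals
`|S₂(v_i, v_j)| / det L'`, where `S₂(v_i, v_j)` is the set of spanning `2`-forests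
`(T₀, T₁)` with the sink in `T₀` and `v_i, v_j ∈ T₁`; in particular every entry of
`(L')⁻¹` is non-negative. -/
theorem reducedLaplacian_inv_entries
    (G : Multigraph) (hG : G.Connected) (s : G.V)
    (i j : {v : G.V // v ≠ s}) :
    letI A : Matrix {v : G.V // v ≠ s} {v : G.V // v ≠ s} ℝ :=
      (G.reducedLaplacian s).map ((↑) : ℤ → ℝ)
    A⁻¹ i j =
      (Nat.card {F : Finset G.E // G.IsForest F ∧ G.numComponents F = 2 ∧
          ¬ G.Reach F s i.1 ∧ G.Reach F i.1 j.1} : ℝ) /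
        ((G.reducedLaplacian s).det : ℝ) ∧
      0 ≤ A⁻¹ i j := by
  set A : Matrix {v : G.V // v ≠ s} {v : G.V // v ≠ s} ℝ :=
      (G.reducedLaplacian s).map ((↑) : ℤ → ℝ) with hAdef
  obtain ⟨hdet, F, hF⟩ := Multigraph.det_redM hG _ {s} (Finset.singleton_nonempty s) rfl
  have hpos := Multigraph.cnt0_pos hF
  rw [← Multigraph.det_reduced] at hdet
  have hA : A * (Matrix.of fun k l => (Multigraph.cnt {s} l.1 k.1 : ℝ) / (Multigraph.cnt0 {s} : ℝ))
      = 1 := by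
    ext k l
    have h := Multigraph.lap_cnt {s} (i := k.1) (j := l.1) (by simpa using k.2) (by simpa using l.2)
    rw [Fintype.sum_eq_add_sum_subtype_ne _ s, Multigraph.cnt_root {s} (by simpa using l.2)
      (by simp), mul_zero, zero_add] at h
    have h' := congrArg (fun z : ℤ => (z : ℝ) / (Multigraph.cnt0 {s} : ℝ)) h
    simp only [Int.cast_sum, Finset.sum_div, Int.cast_mul] at h'
    rw [Matrix.mul_apply, Matrix.one_apply]
    have hne : (Multigraph.cnt0 {s} : ℝ) ≠ 0 := by exact_mod_cast hpos.ne'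
    have he : (k = l) ↔ (k.1 = l.1) := Subtype.ext_iff
    simp only [he]
    convert h' using 1
    · refine Finset.sum_congr rfl fun m _ => ?_
      simp [A, Multigraph.reducedLaplacian, mul_div_assoc]
    · split_ifs <;> simp [hne]
  have hmain : A⁻¹ i j = (Nat.card {F : Finset G.E // G.IsForest F ∧ G.numComponents F = 2 ∧
          ¬ G.Reach F s i.1 ∧ G.Reach F i.1 j.1} : ℝ) /
        ((G.reducedLaplacian s).det : ℝ) := by
    rw [Matrix.inv_eq_right_inv hA, hdet, Matrix.of_apply, ← Multigraph.card_eq_cnt s i.1 j.1 j.2]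
    simp
  refine ⟨hmain, ?_⟩
  rw [hmain, hdet]
  have : (0 : ℝ) < (Multigraph.cnt0 {s} : ℝ) := by exact_mod_cast hpos
  positivity
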